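/- (Batson–Spielman–Srivastava, matrix version) Let v₁, …, v_m be vectors in ℝⁿ and set V = Σᵢ vᵢvᵢ^T. For every ε ∈ (0,1) there exist nonnegative real numbers s₁, …, s_m with |{i : sᵢ ≠ 0}| ≤ ⌈n/ε²⌉ such that (1−ε)² V ≼ Σᵢ sᵢ vᵢvᵢ^T ≼ (1+ε)² V. -/

import Mathlib

noncomputable section

/-- The rank-one outer product `v vᵀ` of a vector `v ∈ ℝⁿ`, as an n×n matrix. -/
def outer {n : ℕ} (v : EuclideanSpace ℝ (Fin n)) : Matrix (Fin n) (Fin n) ℝ :=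
  fun i j => v i * v j

open Matrix

/-- A positive definite matrix whose inverse has trace at most `φ`. -/
def IsBarrier {κ : Type*} [Fintype κ] [DecidableEq κ] (X : Matrix κ κ ℝ) (φ : ℝ) : Prop :=
  X.PosDef ∧ X⁻¹.trace ≤ φ

section Core

variable {κ : Type*} [Fintype κ]

/-- For the diagonal matrix with entries `d`, the average of the upper constraints. -/
lemma sum_sq_inv_div_add_lt [Nonempty κ] {d : κ → ℝ} {φ δ : ℝ} (hd : ∀ j, 0 < d j) (hδ : 0 < δ)
    (hφ : ∑ j, (d j)⁻¹ ≤ φ) :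
    ∑ j, (d j + δ)⁻¹ < φ ∧
      (∑ j, (d j + δ)⁻¹ ^ 2) / (φ - ∑ j, (d j + δ)⁻¹) + ∑ j, (d j + δ)⁻¹ < 1 / δ + φ := by
  have hlt : ∑ j, (d j + δ)⁻¹ < φ := by
    refine lt_of_lt_of_le (Finset.sum_lt_sum_of_nonempty Finset.univ_nonempty fun j _ => ?_) hφ
    exact (inv_lt_inv₀ (by linarith [hd j]) (hd j)).mpr (by linarith)
  refine ⟨hlt, ?_⟩
  have h : δ * ∑ j, (d j + δ)⁻¹ ^ 2 ≤ φ - ∑ j, (d j + δ)⁻¹ := by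
    refine le_trans ?_ (sub_le_sub_right hφ _)
    rw [← Finset.sum_sub_distrib, Finset.mul_sum]
    refine Finset.sum_le_sum fun j _ => ?_
    have h0 := hd j
    have h1 : 0 < d j + δ := by linarith
    have e : (d j)⁻¹ - (d j + δ)⁻¹ = δ * ((d j)⁻¹ * (d j + δ)⁻¹) := by
      field_simp
      ring
    rw [e, sq]
    gcongr
    linarith
  have h2 : (∑ j, (d j + δ)⁻¹ ^ 2) / (φ - ∑ j, (d j + δ)⁻¹) ≤ 1 / δ := by
    rw [div_le_div_iff₀ (sub_pos.mpr hlt) hδ]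
    linarith
  linarith

/-- For the diagonal matrix with entries `d`, the average of the lower constraints. -/
lemma le_sum_sq_inv_div_sub [Nonempty κ] {d : κ → ℝ} {φ δ : ℝ} (hd : ∀ j, 0 < d j) (hδ : 0 < δ)
    (hφ : ∑ j, (d j)⁻¹ ≤ φ) (hφδ : φ * δ < 1) :
    (∀ j, 0 < d j - δ) ∧ ∑ j, (d j)⁻¹ < ∑ j, (d j - δ)⁻¹ ∧
      1 / δ - φ ≤ (∑ j, (d j - δ)⁻¹ ^ 2) / (∑ j, (d j - δ)⁻¹ - ∑ j, (d j)⁻¹) -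
        ∑ j, (d j - δ)⁻¹ := by
  have hpos : ∀ j, 0 < d j - δ := fun j => by
    have h1 : (d j)⁻¹ ≤ φ := le_trans
      (Finset.single_le_sum (fun i _ => inv_nonneg.mpr (hd i).le) (Finset.mem_univ j)) hφ
    have h2 : (d j)⁻¹ * δ < 1 := lt_of_le_of_lt (by gcongr) hφδ
    rw [inv_mul_lt_iff₀ (hd j)] at h2
    linarith
  have hlt : ∑ j, (d j)⁻¹ < ∑ j, (d j - δ)⁻¹ :=
    Finset.sum_lt_sum_of_nonempty Finset.univ_nonempty fun j _ =>
      (inv_lt_inv₀ (hd j) (hpos j)).mpr (by linarith)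
  refine ⟨hpos, hlt, ?_⟩
  set G := ∑ j, (d j)⁻¹ * (d j - δ)⁻¹ with hG
  set H := ∑ j, (d j)⁻¹ * (d j - δ)⁻¹ ^ 2 with hH
  have hΔ : ∑ j, (d j - δ)⁻¹ - ∑ j, (d j)⁻¹ = δ * G := by
    rw [← Finset.sum_sub_distrib, hG, Finset.mul_sum]
    refine Finset.sum_congr rfl fun j _ => ?_
    have := hd j
    have := hpos j
    field_simp
    ring
  have hF : ∑ j, (d j - δ)⁻¹ ^ 2 = G + δ * H := by
    rw [hG, hH, Finset.mul_sum, ← Finset.sum_add_distrib]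
    refine Finset.sum_congr rfl fun j _ => ?_
    have := hd j
    have := hpos j
    field_simp
    ring
  have hCS : G ^ 2 ≤ (∑ j, (d j)⁻¹) * H := by
    refine Finset.sum_sq_le_sum_mul_sum_of_sq_le_mul _
      (fun i _ => inv_nonneg.mpr (hd i).le)
      (fun i _ => mul_nonneg (inv_nonneg.mpr (hd i).le) (sq_nonneg _)) fun i _ => le_of_eq ?_
    ring
  have hH0 : 0 ≤ H :=
    Finset.sum_nonneg fun i _ => mul_nonneg (inv_nonneg.mpr (hd i).le) (sq_nonneg _)
  have hδG : 0 < δ * G := by linarith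
  have hGH : δ * G ^ 2 ≤ H := by
    have h1 : G ^ 2 ≤ φ * H := hCS.trans (by gcongr)
    have h2 : δ * G ^ 2 ≤ δ * (φ * H) := by gcongr
    nlinarith
  have h3 : 1 / δ + δ * G ≤ (∑ j, (d j - δ)⁻¹ ^ 2) / (δ * G) := by
    rw [le_div_iff₀ hδG, hF]
    have : (1 / δ + δ * G) * (δ * G) = G + δ * (δ * G ^ 2) := by
      field_simp
    rw [this]
    gcongr
  rw [hΔ]
  linarith

lemma mul_vecMulVec_self_mul_transpose {μ : Type*} [Fintype μ] (B : Matrix μ κ ℝ) (x : κ → ℝ) :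
    B * vecMulVec x x * Bᵀ = vecMulVec (B *ᵥ x) (B *ᵥ x) := by
  rw [mul_vecMulVec, vecMulVec_mul, vecMul_transpose]

variable [DecidableEq κ]

lemma isBarrier_diagonal_iff {d : κ → ℝ} {φ : ℝ} :
    IsBarrier (diagonal d) φ ↔ (∀ j, 0 < d j) ∧ ∑ j, (d j)⁻¹ ≤ φ := by
  unfold IsBarrier
  rw [posDef_diagonal_iff]
  refine and_congr_right fun hd => ?_
  have : (diagonal d)⁻¹ = diagonal (fun j => (d j)⁻¹) := by
    apply inv_eq_right_inv
    rw [diagonal_mul_diagonal, ← diagonal_one]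
    congr 1
    ext j
    exact mul_inv_cancel₀ (hd j).ne'
  rw [this, trace_diagonal]

lemma IsBarrier.conj {X U : Matrix κ κ ℝ} {φ : ℝ} (h : IsBarrier X φ) (hU : U * Uᵀ = 1) :
    IsBarrier (U * X * Uᵀ) φ := by
  have hU' : Uᵀ * U = 1 := mul_eq_one_comm.mp hU
  refine ⟨?_, ?_⟩
  · rw [← conjTranspose_eq_transpose_of_trivial]
    refine h.1.mul_mul_conjTranspose_same ?_
    intro x y hxy
    have := congrArg (fun z => z ᵥ* Uᵀ) hxy
    simpa [vecMul_vecMul, hU] using this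
  · have hinv : U⁻¹ = Uᵀ := inv_eq_right_inv hU
    have hinv' : Uᵀ⁻¹ = U := inv_eq_right_inv hU'
    rw [Matrix.mul_inv_rev, Matrix.mul_inv_rev, hinv, hinv', trace_mul_comm, Matrix.mul_assoc, hU',
      Matrix.mul_one]
    exact h.2

lemma posDef_diagonal_add_smul_vecMulVec {d w : κ → ℝ} {c : ℝ} (hd : ∀ j, 0 < d j)
    (hc : 0 < 1 + c * ∑ j, w j ^ 2 * (d j)⁻¹) :
    (diagonal d + c • vecMulVec w w).PosDef := by
  refine .of_dotProduct_mulVec_pos ?_ fun x hx => ?_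
  · ext i j
    by_cases h : i = j
    · simp [h]
    · simp [h, Ne.symm h, vecMulVec_apply, mul_comm]
  have hS : 0 < ∑ j, d j * x j ^ 2 := by
    obtain ⟨j, hj⟩ := Function.ne_iff.mp hx
    refine Finset.sum_pos' (fun i _ => mul_nonneg (hd i).le (sq_nonneg _))
      ⟨j, Finset.mem_univ _, mul_pos (hd j) (by simpa [sq_pos_iff] using hj)⟩
  have hCS : (w ⬝ᵥ x) ^ 2 ≤ (∑ j, w j ^ 2 * (d j)⁻¹) * ∑ j, d j * x j ^ 2 := by
    refine Finset.sum_sq_le_sum_mul_sum_of_sq_le_mul _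
      (fun i _ => mul_nonneg (sq_nonneg _) (inv_nonneg.mpr (hd i).le))
      (fun i _ => mul_nonneg (hd i).le (sq_nonneg _)) fun i _ => le_of_eq ?_
    have := (hd i).ne'
    field_simp
  have key : star x ⬝ᵥ ((diagonal d + c • vecMulVec w w) *ᵥ x) =
      ∑ j, d j * x j ^ 2 + c * (w ⬝ᵥ x) ^ 2 := by
    rw [add_mulVec, dotProduct_add, smul_mulVec, dotProduct_smul, vecMulVec_mulVec,
      star_trivial]
    congr 1
    · simp only [dotProduct, mulVec_diagonal]
      exact Finset.sum_congr rfl fun j _ => by ring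
    · simp [dotProduct_comm x w, sq]
  rw [key]
  rcases le_total 0 c with h | h
  · positivity
  · nlinarith [mul_le_mul_of_nonpos_left hCS h, mul_pos hc hS]

lemma trace_inv_diagonal_add_smul_vecMulVec {d w : κ → ℝ} {c : ℝ} (hd : ∀ j, d j ≠ 0)
    (hc : 1 + c * ∑ j, w j ^ 2 * (d j)⁻¹ ≠ 0) :
    (diagonal d + c • vecMulVec w w)⁻¹.trace = ∑ j, (d j)⁻¹ -
      c * (∑ j, w j ^ 2 * (d j)⁻¹ ^ 2) / (1 + c * ∑ j, w j ^ 2 * (d j)⁻¹) := by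
  set p := ∑ j, w j ^ 2 * (d j)⁻¹ with hp
  set y : κ → ℝ := fun j => (d j)⁻¹ * w j with hy
  have hwy : w ⬝ᵥ y = p := Finset.sum_congr rfl fun j _ => by simp [hy]; ring
  have hinv : (diagonal d + c • vecMulVec w w)⁻¹ =
      diagonal (fun j => (d j)⁻¹) - (c / (1 + c * p)) • vecMulVec y y := by
    apply inv_eq_right_inv
    have h1 : diagonal d * diagonal (fun j => (d j)⁻¹) = 1 := by
      rw [diagonal_mul_diagonal, ← diagonal_one]
      congr 1
      ext j
      exact mul_inv_cancel₀ (hd j)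
    have h2 : diagonal d * vecMulVec y y = vecMulVec w y := by
      rw [mul_vecMulVec]
      congr 1
      ext j
      simp [mulVec_diagonal, hy, hd j]
    have h3 : vecMulVec w w * diagonal (fun j => (d j)⁻¹) = vecMulVec w y := by
      rw [vecMulVec_mul]
      congr 1
      ext j
      simp [vecMul_diagonal, hy, mul_comm]
    have h4 : vecMulVec w w * vecMulVec y y = p • vecMulVec w y := by
      rw [vecMulVec_mul_vecMulVec, hwy, vecMulVec_smul]
    rw [add_mul, mul_sub, mul_sub, h1, mul_smul_comm, h2, smul_mul_assoc, h3, smul_mul_assoc,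
      mul_smul_comm, h4, smul_smul, smul_smul]
    have h5 : c = c / (1 + c * p) + c * (c / (1 + c * p)) * p := by
      field_simp
    have h6 : c • vecMulVec w y = (c / (1 + c * p) + c * (c / (1 + c * p)) * p) • vecMulVec w y :=
      congrArg (· • vecMulVec w y) h5
    rw [h6, add_smul]
    abel
  have hyy : y ⬝ᵥ y = ∑ j, w j ^ 2 * (d j)⁻¹ ^ 2 :=
    Finset.sum_congr rfl fun j _ => by simp [hy]; ring
  rw [hinv, trace_sub, trace_smul, trace_diagonal, trace_vecMulVec, hyy, smul_eq_mul]
  ring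

/-- Increasing the upper barrier while subtracting a rank-one matrix. -/
lemma isBarrier_diagonal_sub {d w : κ → ℝ} {φ t : ℝ} (hd : ∀ j, 0 < d j) (ht : 0 < t)
    (hφ : ∑ j, (d j)⁻¹ < φ)
    (h : (∑ j, w j ^ 2 * (d j)⁻¹ ^ 2) / (φ - ∑ j, (d j)⁻¹) + ∑ j, w j ^ 2 * (d j)⁻¹ < t⁻¹) :
    IsBarrier (diagonal d - t • vecMulVec w w) φ := by
  have hq : 0 ≤ ∑ j, w j ^ 2 * (d j)⁻¹ ^ 2 := by positivity
  set p := ∑ j, w j ^ 2 * (d j)⁻¹ with hp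
  set q := ∑ j, w j ^ 2 * (d j)⁻¹ ^ 2
  set Δ := φ - ∑ j, (d j)⁻¹ with hΔ
  have hΔ0 : 0 < Δ := sub_pos.mpr hφ
  have hqΔ : 0 ≤ q / Δ := by positivity
  have htp : t * p < 1 := by
    have : p < t⁻¹ := by linarith
    calc t * p < t * t⁻¹ := by gcongr
      _ = 1 := mul_inv_cancel₀ ht.ne'
  have hc : 0 < 1 + -t * p := by linarith
  rw [sub_eq_add_neg, ← neg_smul]
  refine ⟨posDef_diagonal_add_smul_vecMulVec hd hc, ?_⟩
  rw [trace_inv_diagonal_add_smul_vecMulVec (fun j => (hd j).ne') hc.ne', ← hp]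
  have : t * q / (1 + -t * p) ≤ Δ := by
    rw [div_le_iff₀ hc]
    have h1 : q < (t⁻¹ - p) * Δ := by
      rw [← div_lt_iff₀ hΔ0]; linarith
    have h2 : t * q ≤ t * ((t⁻¹ - p) * Δ) := by gcongr
    have h3 : t * ((t⁻¹ - p) * Δ) = (t * t⁻¹ - t * p) * Δ := by ring
    rw [h3, mul_inv_cancel₀ ht.ne'] at h2
    linarith
  have e : -t * q / (1 + -t * p) = -(t * q / (1 + -t * p)) := by ring
  rw [e]
  linarith

/-- Raising the lower barrier while adding a rank-one matrix. -/
lemma isBarrier_diagonal_add {d w : κ → ℝ} {φ t : ℝ} (hd : ∀ j, 0 < d j) (ht : 0 < t)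
    (hφ : φ < ∑ j, (d j)⁻¹)
    (h : t⁻¹ ≤ (∑ j, w j ^ 2 * (d j)⁻¹ ^ 2) / (∑ j, (d j)⁻¹ - φ) - ∑ j, w j ^ 2 * (d j)⁻¹) :
    IsBarrier (diagonal d + t • vecMulVec w w) φ := by
  have hp0 : 0 ≤ ∑ j, w j ^ 2 * (d j)⁻¹ :=
    Finset.sum_nonneg fun j _ => mul_nonneg (sq_nonneg _) (inv_nonneg.mpr (hd j).le)
  set p := ∑ j, w j ^ 2 * (d j)⁻¹ with hp
  set q := ∑ j, w j ^ 2 * (d j)⁻¹ ^ 2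
  set Δ := ∑ j, (d j)⁻¹ - φ with hΔ
  have hΔ0 : 0 < Δ := sub_pos.mpr hφ
  have hc : 0 < 1 + t * p := by positivity
  refine ⟨posDef_diagonal_add_smul_vecMulVec hd hc, ?_⟩
  rw [trace_inv_diagonal_add_smul_vecMulVec (fun j => (hd j).ne') hc.ne', ← hp]
  have : Δ ≤ t * q / (1 + t * p) := by
    rw [le_div_iff₀ hc]
    have h1 : (t⁻¹ + p) * Δ ≤ q := by
      rw [← le_div_iff₀ hΔ0]; linarith
    have h2 : t * ((t⁻¹ + p) * Δ) ≤ t * q := by gcongr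
    have h3 : t * ((t⁻¹ + p) * Δ) = (t * t⁻¹ + t * p) * Δ := by ring
    rw [h3, mul_inv_cancel₀ ht.ne'] at h2
    linarith
  linarith

lemma sum_sum_sq_mul_of_sum_vecMulVec_eq_one {ι : Type*} [Fintype ι] {w : ι → κ → ℝ}
    (hw : ∑ i, vecMulVec (w i) (w i) = 1) (g : κ → ℝ) :
    ∑ i, ∑ j, w i j ^ 2 * g j = ∑ j, g j := by
  rw [Finset.sum_comm]
  refine Finset.sum_congr rfl fun j _ => ?_
  have := congrFun (congrFun hw j) j
  simp only [Matrix.sum_apply, vecMulVec_apply, one_apply_eq] at this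
  rw [← Finset.sum_mul]
  simp [sq, this]

lemma exists_barrier_step_diagonal [Nonempty κ] {ι : Type*} [Fintype ι] {w : ι → κ → ℝ}
    (hw : ∑ i, vecMulVec (w i) (w i) = 1) {a b : κ → ℝ} {φU φL δU δL : ℝ}
    (hU : IsBarrier (diagonal a) φU) (hL : IsBarrier (diagonal b) φL)
    (hδU : 0 < δU) (hδL : 0 < δL) (hφL : φL * δL < 1) (h : 1 / δU + φU ≤ 1 / δL - φL) :
    ∃ i, ∃ t : ℝ, 0 < t ∧
      IsBarrier (diagonal (fun j => a j + δU) - t • vecMulVec (w i) (w i)) φU ∧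
      IsBarrier (diagonal (fun j => b j - δL) + t • vecMulVec (w i) (w i)) φL := by
  rw [isBarrier_diagonal_iff] at hU hL
  obtain ⟨ha, haφ⟩ := hU
  obtain ⟨hb, hbφ⟩ := hL
  obtain ⟨hU1, hU2⟩ := sum_sq_inv_div_add_lt ha hδU haφ
  obtain ⟨hb', hL1, hL2⟩ := le_sum_sq_inv_div_sub hb hδL hbφ hφL
  have ha' : ∀ j, 0 < a j + δU := fun j => by linarith [ha j]
  have hsum : ∑ i, ((∑ j, w i j ^ 2 * (a j + δU)⁻¹ ^ 2) / (φU - ∑ j, (a j + δU)⁻¹) +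
        ∑ j, w i j ^ 2 * (a j + δU)⁻¹) <
      ∑ i, ((∑ j, w i j ^ 2 * (b j - δL)⁻¹ ^ 2) / (∑ j, (b j - δL)⁻¹ - ∑ j, (b j)⁻¹) -
        ∑ j, w i j ^ 2 * (b j - δL)⁻¹) := by
    rw [Finset.sum_add_distrib, Finset.sum_sub_distrib, ← Finset.sum_div, ← Finset.sum_div]
    simp only [sum_sum_sq_mul_of_sum_vecMulVec_eq_one hw]
    linarith
  obtain ⟨i, -, hi⟩ := Finset.exists_lt_of_sum_lt hsum
  set L := (∑ j, w i j ^ 2 * (b j - δL)⁻¹ ^ 2) / (∑ j, (b j - δL)⁻¹ - ∑ j, (b j)⁻¹) -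
        ∑ j, w i j ^ 2 * (b j - δL)⁻¹ with hLdef
  have hL0 : 0 < L := by
    refine lt_of_le_of_lt (add_nonneg (div_nonneg ?_ (sub_pos.mpr hU1).le) ?_) hi
    · positivity
    · exact Finset.sum_nonneg fun j _ => mul_nonneg (sq_nonneg _) (inv_nonneg.mpr (ha' j).le)
  refine ⟨i, L⁻¹, inv_pos.mpr hL0, ?_, ?_⟩
  · refine isBarrier_diagonal_sub ha' (inv_pos.mpr hL0) hU1 ?_
    rwa [inv_inv]
  · have := isBarrier_diagonal_add (w := w i) hb' (inv_pos.mpr hL0) hL1 (by rw [inv_inv])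
    exact ⟨this.1, this.2.trans hbφ⟩

lemma exists_orthogonal_diagonalization {A : Matrix κ κ ℝ} (hA : A.IsHermitian) :
    ∃ U : Matrix κ κ ℝ, U * Uᵀ = 1 ∧ A = U * diagonal hA.eigenvalues * Uᵀ := by
  refine ⟨hA.eigenvectorUnitary, ?_, ?_⟩
  · rw [← conjTranspose_eq_transpose_of_trivial]
    exact Unitary.coe_mul_star_self hA.eigenvectorUnitary
  · have := hA.spectral_theorem
    rw [Unitary.conjStarAlgAut_apply, star_eq_conjTranspose,
      conjTranspose_eq_transpose_of_trivial] at this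
    exact this

lemma exists_barrier_step [Nonempty κ] {ι : Type*} [Fintype ι] {w : ι → κ → ℝ}
    (hw : ∑ i, vecMulVec (w i) (w i) = 1) {A : Matrix κ κ ℝ} {u l φU φL δU δL : ℝ}
    (hU : IsBarrier (u • 1 - A) φU) (hL : IsBarrier (A - l • 1) φL)
    (hδU : 0 < δU) (hδL : 0 < δL) (hφL : φL * δL < 1) (h : 1 / δU + φU ≤ 1 / δL - φL) :
    ∃ i, ∃ t : ℝ, 0 < t ∧
      IsBarrier ((u + δU) • 1 - (A + t • vecMulVec (w i) (w i))) φU ∧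
      IsBarrier (A + t • vecMulVec (w i) (w i) - (l + δL) • 1) φL := by
  have hA : A.IsHermitian := by
    have := hL.1.isHermitian.add (isHermitian_one.smul (k := l) (by simp [IsSelfAdjoint]))
    simpa using this
  obtain ⟨U, hUU, hAU⟩ := exists_orthogonal_diagonalization hA
  have hUU' : Uᵀ * U = 1 := mul_eq_one_comm.mp hUU
  have hUU'' : Uᵀ * Uᵀᵀ = 1 := by rwa [transpose_transpose]
  set ev := hA.eigenvalues
  have hDA : Uᵀ * A * U = diagonal ev := by
    rw [hAU]
    calc Uᵀ * (U * diagonal ev * Uᵀ) * U = (Uᵀ * U) * diagonal ev * (Uᵀ * U) := by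
          simp only [Matrix.mul_assoc]
      _ = _ := by rw [hUU', Matrix.one_mul, Matrix.mul_one]
  have hdu : ∀ c : ℝ, (c • 1 : Matrix κ κ ℝ) = diagonal fun _ => c := fun c => by
    rw [smul_one_eq_diagonal]
  have hU1 : IsBarrier (diagonal fun j => u - ev j) φU := by
    have := hU.conj hUU''
    rwa [transpose_transpose, mul_sub, sub_mul, hDA, mul_smul_comm, smul_mul_assoc,
      Matrix.mul_one, hUU', hdu, diagonal_sub] at this
  have hL1 : IsBarrier (diagonal fun j => ev j - l) φL := by
    have := hL.conj hUU''
    rwa [transpose_transpose, mul_sub, sub_mul, hDA, mul_smul_comm, smul_mul_assoc,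
      Matrix.mul_one, hUU', hdu, diagonal_sub] at this
  have hw' : ∑ i, vecMulVec (Uᵀ *ᵥ w i) (Uᵀ *ᵥ w i) = 1 := by
    simp only [← mul_vecMulVec_self_mul_transpose]
    rw [← Finset.sum_mul, ← Finset.mul_sum, hw, Matrix.mul_one, hUU'']
  obtain ⟨i, t, ht, h1, h2⟩ := exists_barrier_step_diagonal hw' hU1 hL1 hδU hδL hφL h
  have hvec : U * vecMulVec (Uᵀ *ᵥ w i) (Uᵀ *ᵥ w i) * Uᵀ = vecMulVec (w i) (w i) := by
    rw [mul_vecMulVec_self_mul_transpose, mulVec_mulVec, hUU, one_mulVec]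
  refine ⟨i, t, ht, ?_, ?_⟩
  · have e : (diagonal fun j => u - ev j + δU) = (u + δU) • 1 - diagonal ev := by
      rw [hdu, diagonal_sub]
      congr 1
      ext j
      ring
    have := h1.conj hUU
    rw [e, mul_sub, sub_mul, mul_sub, sub_mul, ← hAU, mul_smul_comm, smul_mul_assoc,
      Matrix.mul_one, hUU, mul_smul_comm, smul_mul_assoc, hvec] at this
    rwa [← sub_sub]
  · have e : (diagonal fun j => ev j - l - δL) = diagonal ev - (l + δL) • 1 := by
      rw [hdu, diagonal_sub]
      congr 1
      ext j
      ring
    have := h2.conj hUU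
    rw [e, mul_add, add_mul, mul_sub, sub_mul, ← hAU, mul_smul_comm, smul_mul_assoc,
      Matrix.mul_one, hUU, mul_smul_comm, smul_mul_assoc, hvec] at this
    rwa [add_sub_right_comm]

lemma exists_barrier_iterate [Nonempty κ] {ι : Type*} [Fintype ι] [DecidableEq ι] {w : ι → κ → ℝ}
    (hw : ∑ i, vecMulVec (w i) (w i) = 1) {φU φL δU δL : ℝ} (hφU0 : 0 < φU) (hφL0 : 0 < φL)
    (hδU : 0 < δU) (hδL : 0 < δL) (hφL : φL * δL < 1) (h : 1 / δU + φU ≤ 1 / δL - φL) (k : ℕ) :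
    ∃ s : ι → ℝ, (∀ i, 0 ≤ s i) ∧ (Finset.univ.filter fun i => s i ≠ 0).card ≤ k ∧
      IsBarrier ((Fintype.card κ / φU + k * δU) • 1 - ∑ i, s i • vecMulVec (w i) (w i)) φU ∧
      IsBarrier (∑ i, s i • vecMulVec (w i) (w i) - (-(Fintype.card κ / φL) + k * δL) • 1) φL := by
  have hcard : (0 : ℝ) < Fintype.card κ := by exact_mod_cast Fintype.card_pos
  induction k with
  | zero =>
    have h0 : ∀ φ : ℝ, 0 < φ → IsBarrier ((Fintype.card κ / φ) • (1 : Matrix κ κ ℝ)) φ := by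
      intro φ hφ
      rw [smul_one_eq_diagonal, isBarrier_diagonal_iff]
      refine ⟨fun _ => by positivity, le_of_eq ?_⟩
      simp
      field_simp
    refine ⟨0, fun _ => le_rfl, by simp, ?_, ?_⟩
    · simpa using h0 φU hφU0
    · simpa using h0 φL hφL0
  | succ k ih =>
    obtain ⟨s, hs, hsk, h1, h2⟩ := ih
    obtain ⟨i, t, ht, h1', h2'⟩ := exists_barrier_step hw h1 h2 hδU hδL hφL h
    have hsum : ∑ j, (s + Pi.single i t : ι → ℝ) j • vecMulVec (w j) (w j) =
        ∑ j, s j • vecMulVec (w j) (w j) + t • vecMulVec (w i) (w i) := by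
      simp only [Pi.add_apply, add_smul, Finset.sum_add_distrib]
      congr 1
      rw [Finset.sum_eq_single i]
      · simp
      · intro j _ hj
        simp [Pi.single_eq_of_ne hj]
      · simp
    refine ⟨s + Pi.single i t, fun j => ?_, ?_, ?_, ?_⟩
    · exact add_nonneg (hs j) ((Pi.single_nonneg.mpr ht.le : (0 : ι → ℝ) ≤ Pi.single i t) j)
    · refine (Finset.card_le_card (t := insert i (Finset.univ.filter fun j => s j ≠ 0)) ?_).trans
        ((Finset.card_insert_le _ _).trans (by omega))
      intro j hj
      by_cases hji : j = i
      · simp [hji]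
      · simpa [hji] using hj
    · rw [hsum]
      convert h1' using 3
      push_cast
      ring
    · rw [hsum]
      convert h2' using 3
      push_cast
      ring

/-- Spectral sparsification of a decomposition of the identity. -/
lemma exists_sparse_identity_approximation [Nonempty κ] {ι : Type*} [Fintype ι] [DecidableEq ι]
    {w : ι → κ → ℝ} (hw : ∑ i, vecMulVec (w i) (w i) = 1) {ε : ℝ} (hε0 : 0 < ε) (hε1 : ε < 1) :
    ∃ s : ι → ℝ, (∀ i, 0 ≤ s i) ∧
      (Finset.univ.filter fun i => s i ≠ 0).card ≤ ⌈(Fintype.card κ : ℝ) / ε ^ 2⌉₊ ∧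
      PosSemidef ((∑ i, s i • vecMulVec (w i) (w i)) - (1 - ε) ^ 2 • 1) ∧
      PosSemidef ((1 + ε) ^ 2 • 1 - ∑ i, s i • vecMulVec (w i) (w i)) := by
  have hcard : (0 : ℝ) < Fintype.card κ := by exact_mod_cast Fintype.card_pos
  have hQ := Nat.le_ceil ((Fintype.card κ : ℝ) / ε ^ 2)
  set Q := ⌈(Fintype.card κ : ℝ) / ε ^ 2⌉₊
  set N := (Fintype.card κ : ℝ)
  have h1ε : 0 < 1 - ε := by linarith
  have h1ε' : 0 < 1 + ε := by linarith
  obtain ⟨s, hs, hsQ, hU, hL⟩ := exists_barrier_iterate hw (φU := ε * (1 - ε) / (1 + ε)) (φL := ε)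
    (δU := (1 + ε) / (1 - ε)) (δL := 1) (by positivity) hε0 (by positivity) one_pos (by linarith)
    (le_of_eq (by field_simp)) Q
  set u := N / (ε * (1 - ε) / (1 + ε)) + Q * ((1 + ε) / (1 - ε)) with hu
  set l := -(N / ε) + Q * 1 with hl
  have hQ' : N ≤ Q * ε ^ 2 := by rwa [div_le_iff₀ (by positivity)] at hQ
  have hlε : l * ε = Q * ε - N := by rw [hl]; field_simp; ring
  have hl0 : 0 < l := by
    have : N < Q * ε := by
      have hQ0 : 0 < (Q : ℝ) * ε ^ 2 := lt_of_lt_of_le hcard hQ'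
      have : 0 < (Q : ℝ) := by
        by_contra hneg
        nlinarith [sq_nonneg ε]
      nlinarith [mul_pos this hε0]
    by_contra hneg
    nlinarith
  have huε : u * (ε * (1 - ε)) = (1 + ε) * (N + Q * ε) := by
    rw [hu]; field_simp
  have hul : (1 - ε) ^ 2 * u ≤ (1 + ε) ^ 2 * l := by
    have : (1 - ε) ^ 2 * u * ε ≤ (1 + ε) ^ 2 * l * ε := by
      have e1 : (1 - ε) ^ 2 * u * ε = (1 - ε) * (1 + ε) * (N + Q * ε) := by
        linear_combination (1 - ε) * huε
      have e2 : (1 + ε) ^ 2 * l * ε = (1 + ε) * (1 + ε) * (Q * ε - N) := by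
        linear_combination (1 + ε) ^ 2 * hlε
      rw [e1, e2]
      nlinarith [mul_nonneg h1ε'.le (sub_nonneg.mpr hQ')]
    exact le_of_mul_le_mul_right this hε0
  set c := (1 - ε) ^ 2 / l with hc
  have hc0 : 0 < c := by positivity
  have hcl : c * l = (1 - ε) ^ 2 := by rw [hc]; field_simp
  have hcu : c * u ≤ (1 + ε) ^ 2 := by
    rw [hc, div_mul_eq_mul_div, div_le_iff₀ hl0]; exact hul
  have hsum : ∑ i, (c * s i) • vecMulVec (w i) (w i) =
      c • ∑ i, s i • vecMulVec (w i) (w i) := by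
    simp only [Finset.smul_sum, smul_smul]
  refine ⟨fun i => c * s i, fun i => mul_nonneg hc0.le (hs i), ?_, ?_, ?_⟩
  · simpa [hc0.ne'] using hsQ
  · rw [hsum, ← hcl, mul_smul, ← smul_sub]
    exact hL.1.posSemidef.smul hc0.le
  · have h1 := (hU.1.posSemidef.smul hc0.le).add
      ((PosSemidef.one (n := κ) (R := ℝ)).smul (sub_nonneg.mpr hcu))
    rw [hsum]
    convert h1 using 1
    rw [smul_sub, smul_smul, sub_smul]
    abel

/-- A family of vectors is the image of part of a decomposition of the identity whose remaining
vectors are sent to zero. -/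
lemma exists_isotropic_lift {ι : Type*} [Fintype ι] (v : ι → κ → ℝ) :
    ∃ (C : Matrix κ κ ℝ) (w : ι ⊕ κ → κ → ℝ), ∑ i, vecMulVec (w i) (w i) = 1 ∧
      (∀ i, C *ᵥ w (.inl i) = v i) ∧ ∀ j, C *ᵥ w (.inr j) = 0 := by
  have hV : (∑ i, vecMulVec (v i) (v i)).PosSemidef :=
    posSemidef_sum _ fun i _ => by simpa using posSemidef_vecMulVec_self_star (v i)
  obtain ⟨U, hUU, hVU⟩ := exists_orthogonal_diagonalization hV.isHermitian
  have hUU' : Uᵀ * U = 1 := mul_eq_one_comm.mp hUU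
  have hev : ∀ j, 0 ≤ hV.isHermitian.eigenvalues j := hV.eigenvalues_nonneg
  set ev := hV.isHermitian.eigenvalues
  set a : ι → κ → ℝ := fun i => Uᵀ *ᵥ v i with ha
  have haa : ∑ i, vecMulVec (a i) (a i) = diagonal ev := by
    simp only [ha, ← mul_vecMulVec_self_mul_transpose]
    rw [← Finset.sum_mul, ← Finset.mul_sum, hVU, transpose_transpose]
    calc Uᵀ * (U * diagonal ev * Uᵀ) * U = (Uᵀ * U) * diagonal ev * (Uᵀ * U) := by
          simp only [Matrix.mul_assoc]
      _ = _ := by rw [hUU', Matrix.one_mul, Matrix.mul_one]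
  have haa' : ∀ j k, ∑ i, a i j * a i k = if j = k then ev j else 0 := fun j k => by
    have := congrFun (congrFun haa j) k
    simpa [Matrix.sum_apply, vecMulVec_apply, diagonal_apply] using this
  have ha0 : ∀ j, ev j = 0 → ∀ i, a i j = 0 := fun j hj i => by
    have h1 := haa' j j
    rw [if_pos rfl, hj, Finset.sum_eq_zero_iff_of_nonneg fun i _ => mul_self_nonneg _] at h1
    exact mul_self_eq_zero.mp (h1 i (Finset.mem_univ i))
  refine ⟨U * diagonal fun j => √(ev j),
    Sum.elim (fun i j => (√(ev j))⁻¹ * a i j)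
      (fun k => if ev k = 0 then Pi.single k 1 else 0), ?_, ?_, ?_⟩
  · ext j k
    simp only [Matrix.sum_apply, vecMulVec_apply, Fintype.sum_sum_type, Sum.elim_inl, Sum.elim_inr]
    have e1 : ∑ i, (√(ev j))⁻¹ * a i j * ((√(ev k))⁻¹ * a i k) =
        (√(ev j))⁻¹ * (√(ev k))⁻¹ * ∑ i, a i j * a i k := by
      rw [Finset.mul_sum]
      exact Finset.sum_congr rfl fun i _ => by ring
    have e2 : ∑ x, (if ev x = 0 then Pi.single x 1 else 0 : κ → ℝ) j *
        (if ev x = 0 then Pi.single x 1 else 0 : κ → ℝ) k =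
        if j = k then (if ev j = 0 then 1 else 0) else 0 := by
      rw [Finset.sum_eq_single j]
      · by_cases hj : ev j = 0 <;> simp [hj, Pi.single_apply, eq_comm]
      · intro x _ hx
        by_cases hx0 : ev x = 0 <;> simp [hx0, Pi.single_apply, hx.symm]
      · simp
    rw [e1, e2, haa', one_apply]
    by_cases hjk : j = k
    · subst hjk
      by_cases hj : ev j = 0
      · simp [hj]
      · have h1 : √(ev j) ≠ 0 := by
          rw [Real.sqrt_ne_zero (hev j)]; exact hj
        have h2 : √(ev j) * √(ev j) = ev j := Real.mul_self_sqrt (hev j)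
        simp only [if_true, hj, if_false, add_zero]
        rw [← mul_inv, h2, inv_mul_cancel₀ hj]
    · simp [hjk]
  · intro i
    have : (diagonal fun j => √(ev j)) *ᵥ (fun j => (√(ev j))⁻¹ * a i j) = a i := by
      ext j
      rw [mulVec_diagonal]
      by_cases hj : ev j = 0
      · simp [hj, ha0 j hj i]
      · have h1 : √(ev j) ≠ 0 := by
          rw [Real.sqrt_ne_zero (hev j)]; exact hj
        rw [mul_inv_cancel_left₀ h1]
    rw [Sum.elim_inl, ← mulVec_mulVec, this, ha, mulVec_mulVec, hUU, one_mulVec]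
  · intro k
    rw [Sum.elim_inr, ← mulVec_mulVec]
    have : (diagonal fun j => √(ev j)) *ᵥ (if ev k = 0 then Pi.single k 1 else 0) = 0 := by
      ext j
      rw [mulVec_diagonal]
      by_cases hk : ev k = 0
      · by_cases hjk : j = k
        · subst hjk; simp [hk]
        · simp [hk, hjk]
      · simp [hk]
    rw [this, mulVec_zero]

end Core

lemma outer_eq_vecMulVec {n : ℕ} (v : EuclideanSpace ℝ (Fin n)) :
    outer v = vecMulVec v.ofLp v.ofLp := rfl

/-- **Batson–Spielman–Srivastava, matrix version.** Let
`v₁, …, v_m ∈ ℝⁿ` and `V = ∑ᵢ vᵢvᵢᵀ`. For every `ε ∈ (0, 1)` there are nonnegative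
reals `s₁, …, s_m`, at most `⌈n/ε²⌉` of them nonzero, with
`(1-ε)² V ≼ ∑ᵢ sᵢ vᵢvᵢᵀ ≼ (1+ε)² V`. -/
theorem exists_sparse_weighted_approximation
    {n m : ℕ} (v : Fin m → EuclideanSpace ℝ (Fin n)) (ε : ℝ) (hε : ε ∈ Set.Ioo (0 : ℝ) 1) :
    ∃ s : Fin m → ℝ,
      (∀ i, 0 ≤ s i) ∧
      (Finset.univ.filter (fun i => s i ≠ 0)).card ≤ ⌈(n : ℝ) / ε ^ 2⌉₊ ∧
      Matrix.PosSemidef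
        ((∑ i, s i • outer (v i)) - (1 - ε) ^ 2 • ∑ i, outer (v i)) ∧
      Matrix.PosSemidef
        ((1 + ε) ^ 2 • (∑ i, outer (v i)) - ∑ i, s i • outer (v i)) := by
  rcases Nat.eq_zero_or_pos n with rfl | hn
  · refine ⟨0, fun _ => le_rfl, by simp, ?_, ?_⟩ <;>
    · convert PosSemidef.zero (n := Fin 0) (R := ℝ) using 1
      exact Subsingleton.elim _ _
  have : Nonempty (Fin n) := ⟨⟨0, hn⟩⟩
  obtain ⟨C, w, hw, hCl, hCr⟩ := exists_isotropic_lift fun i => (v i).ofLp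
  obtain ⟨s, hs, hcard, h1, h2⟩ := exists_sparse_identity_approximation hw hε.1 hε.2
  rw [Fintype.card_fin] at hcard
  have hsum : ∀ r : Fin m ⊕ Fin n → ℝ,
      C * (∑ i, r i • vecMulVec (w i) (w i)) * Cᵀ = ∑ i, r (.inl i) • outer (v i) := fun r => by
    rw [Finset.mul_sum, Finset.sum_mul]
    simp only [mul_smul_comm, smul_mul_assoc,
      mul_vecMulVec_self_mul_transpose, Fintype.sum_sum_type, hCl, hCr, zero_vecMulVec, smul_zero,
      Finset.sum_const_zero, add_zero, outer_eq_vecMulVec]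
  have hone : C * 1 * Cᵀ = ∑ i, outer (v i) := by
    have := hsum fun _ => 1
    simpa only [one_smul, hw] using this
  refine ⟨fun i => s (.inl i), fun i => hs _, ?_, ?_, ?_⟩
  · refine le_trans ?_ hcard
    refine Finset.card_le_card_of_injOn Sum.inl (fun i hi => ?_) Sum.inl_injective.injOn
    simpa using hi
  · have := h1.mul_mul_conjTranspose_same C
    rwa [conjTranspose_eq_transpose_of_trivial, mul_sub, sub_mul, hsum, mul_smul_comm,
      smul_mul_assoc, hone] at this
  · have := h2.mul_mul_conjTranspose_same C
    rwa [conjTranspose_eq_transpose_of_trivial, mul_sub, sub_mul, hsum, mul_smul_comm,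
      smul_mul_assoc, hone] at this

end
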